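/- arXiv:1504.07699 — 4 statements merged into one kernel-verified Lean document; each statement's English description precedes it below -/
import Mathlib

section
/- Let H be a real Hilbert space, S ⊆ H a closed subspace, λ > 0, and M ∈ S++(H). Define h^M : H → (−∞,+∞] by h^M(x) = 0 if ‖P^M_S x‖_M ≤ λ and h^M(x) = +∞ otherwise, where P^M_S is the orthogonal projector onto S in H_M. Then for every x ∈ H: if ‖P^M_S x‖_M > λ then prox^M_{h^M}(x) = (Id − P^M_S)x + (λ/‖P^M_S x‖_M) P^M_S x, and if ‖P^M_S x‖_M ≤ λ then prox^M_{h^M}(x) = x. -/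
open scoped RealInnerProductSpace

section MetricProjection

variable {H : Type*} [NormedAddCommGroup H] [InnerProductSpace ℝ H] {M : H →L[ℝ] H}

/-- A strongly positive operator is positive. -/
theorem inner_map_self_nonneg_of_bound
    (hMpos : ∃ m > (0 : ℝ), ∀ u : H, m * ‖u‖ ^ 2 ≤ ⟪M u, u⟫) (u : H) : 0 ≤ ⟪M u, u⟫ := by
  obtain ⟨m, hm, h⟩ := hMpos
  exact le_trans (by positivity) (h u)

theorem eq_zero_of_inner_map_self_nonpos
    (hMpos : ∃ m > (0 : ℝ), ∀ u : H, m * ‖u‖ ^ 2 ≤ ⟪M u, u⟫) {u : H} (hu : ⟪M u, u⟫ ≤ 0) :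
    u = 0 := by
  obtain ⟨m, hm, h⟩ := hMpos
  by_contra hne
  have : 0 < ‖u‖ := norm_pos_iff.mpr hne
  have : 0 < m * ‖u‖ ^ 2 := by positivity
  linarith [h u]

theorem inner_map_comm (hMsa : ∀ u v : H, ⟪M u, v⟫ = ⟪u, M v⟫) (u v : H) :
    ⟪M u, v⟫ = ⟪M v, u⟫ := by
  rw [hMsa, real_inner_comm]

/-- Cauchy–Schwarz inequality in the metric of `M`. -/
theorem inner_map_le_sqrt_mul_sqrt (hMsa : ∀ u v : H, ⟪M u, v⟫ = ⟪u, M v⟫)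
    (hMpos : ∃ m > (0 : ℝ), ∀ u : H, m * ‖u‖ ^ 2 ≤ ⟪M u, u⟫) (a b : H) :
    ⟪M a, b⟫ ≤ √⟪M a, a⟫ * √⟪M b, b⟫ := by
  have hpos := inner_map_self_nonneg_of_bound hMpos
  rw [← Real.sqrt_mul (hpos a)]
  apply Real.le_sqrt_of_sq_le
  have hdiscrim : discrim ⟪M b, b⟫ (2 * ⟪M a, b⟫) ⟪M a, a⟫ ≤ 0 := by
    refine discrim_le_zero fun t => ?_
    have h := hpos (a + t • b)
    simp only [map_add, map_smul, inner_add_left, inner_add_right, real_inner_smul_left,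
      real_inner_smul_right, inner_map_comm hMsa b a] at h
    linarith
  rw [discrim] at hdiscrim
  linarith

/-- A point of a set satisfying the variational inequality is the unique best approximation
in the metric of `M`. -/
theorem isBestApprox_iff_eq_of_variational (hMsa : ∀ u v : H, ⟪M u, v⟫ = ⟪u, M v⟫)
    (hMpos : ∃ m > (0 : ℝ), ∀ u : H, m * ‖u‖ ^ 2 ≤ ⟪M u, u⟫) {C : H → Prop} {x q : H}
    (hq : C q) (hvar : ∀ y, C y → 0 ≤ ⟪M (x - q), q - y⟫) (p : H) :
    (C p ∧ ∀ y, C y → ⟪M (x - p), x - p⟫ ≤ ⟪M (x - y), x - y⟫) ↔ p = q := by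
  have key : ∀ y, C y →
      ⟪M (x - q), x - q⟫ + ⟪M (q - y), q - y⟫ ≤ ⟪M (x - y), x - y⟫ := by
    intro y hy
    have hsplit : x - y = (x - q) + (q - y) := by abel
    rw [hsplit, map_add, inner_add_left, inner_add_right, inner_add_right,
      inner_map_comm hMsa (q - y) (x - q)]
    linarith [hvar y hy]
  constructor
  · rintro ⟨hp, hmin⟩
    have hzero : q - p = 0 :=
      eq_zero_of_inner_map_self_nonpos hMpos (by linarith [key p hp, hmin q hq])
    exact (sub_eq_zero.mp hzero).symm
  · rintro rfl
    exact ⟨hq, fun y hy => by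
      linarith [key y hy, inner_map_self_nonneg_of_bound hMpos (p - y)]⟩

/-- The projector onto `S` in the metric of `M` is characterised by orthogonality. -/
theorem metricProjector_eq_of_orthogonal
    (hMpos : ∃ m > (0 : ℝ), ∀ u : H, m * ‖u‖ ^ 2 ≤ ⟪M u, u⟫) {S : Submodule ℝ H} {P : H → H}
    (hPmem : ∀ u : H, P u ∈ S) (hPorth : ∀ u : H, ∀ s ∈ S, ⟪M (u - P u), s⟫ = 0)
    {u v : H} (hv : v ∈ S) (horth : ∀ s ∈ S, ⟪M (u - v), s⟫ = 0) : P u = v := by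
  have hmem : P u - v ∈ S := S.sub_mem (hPmem u) hv
  refine sub_eq_zero.mp (eq_zero_of_inner_map_self_nonpos hMpos (le_of_eq ?_))
  have hsplit : P u - v = (u - v) - (u - P u) := by abel
  nth_rewrite 1 [hsplit]
  rw [map_sub, inner_sub_left, horth _ hmem, hPorth u _ hmem, sub_zero]

end MetricProjection

/-- Corollary 3.1 (weighted group constraint part): the proximity operator, in the
metric induced by a strongly positive self-adjoint `M`, of the indicator of
`{y : ‖P^M_S y‖_M ≤ λ}`, where `P^M_S` is the `M`-orthogonal projector onto `S`;
i.e. the `M`-orthogonal projection onto this closed convex set. -/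
theorem prox_group_constraint_metric
    {H : Type*} [NormedAddCommGroup H] [InnerProductSpace ℝ H] [CompleteSpace H]
    (S : Submodule ℝ H) (lam : ℝ) (hlam : 0 < lam)
    (M : H →L[ℝ] H)
    (hMsa : ∀ u v : H, ⟪M u, v⟫ = ⟪u, M v⟫)
    (hMpos : ∃ m > (0 : ℝ), ∀ u : H, m * ‖u‖ ^ 2 ≤ ⟪M u, u⟫)
    -- `P` is the orthogonal projector onto `S` in the metric of `M`
    (P : H → H) (hPmem : ∀ u : H, P u ∈ S)
    (hPorth : ∀ u : H, ∀ s ∈ S, ⟪M (u - P u), s⟫ = 0)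
    (x : H) :
    (Real.sqrt ⟪M (P x), P x⟫ > lam →
      ∀ p : H,
        (Real.sqrt ⟪M (P p), P p⟫ ≤ lam ∧
          ∀ y : H, Real.sqrt ⟪M (P y), P y⟫ ≤ lam →
            ⟪M (x - p), x - p⟫ ≤ ⟪M (x - y), x - y⟫)
          ↔ p = (x - P x) + (lam / Real.sqrt ⟪M (P x), P x⟫) • P x) ∧
    (Real.sqrt ⟪M (P x), P x⟫ ≤ lam →
      ∀ p : H,
        (Real.sqrt ⟪M (P p), P p⟫ ≤ lam ∧
          ∀ y : H, Real.sqrt ⟪M (P y), P y⟫ ≤ lam →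
            ⟪M (x - p), x - p⟫ ≤ ⟪M (x - y), x - y⟫)
          ↔ p = x) := by
  constructor
  · intro hx p
    set N := √⟪M (P x), P x⟫
    have hNpos : 0 < N := hlam.trans hx
    have hNsq : ⟪M (P x), P x⟫ = N * N :=
      (Real.mul_self_sqrt (inner_map_self_nonneg_of_bound hMpos _)).symm
    have hPq : P ((x - P x) + (lam / N) • P x) = (lam / N) • P x :=
      metricProjector_eq_of_orthogonal hMpos hPmem hPorth (S.smul_mem _ (hPmem x))
        (fun s hs => by rw [add_sub_cancel_right]; exact hPorth x s hs)
    refine isBestApprox_iff_eq_of_variational (C := fun y => √⟪M (P y), P y⟫ ≤ lam)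
      hMsa hMpos ?_ ?_ p
    · simp only [hPq, map_smul, real_inner_smul_left, real_inner_smul_right, hNsq]
      have hsq : lam / N * (lam / N * (N * N)) = lam ^ 2 := by field_simp
      rw [hsq, Real.sqrt_sq hlam.le]
    · intro y hy
      have hxq : x - ((x - P x) + (lam / N) • P x) = (1 - lam / N) • P x := by
        rw [sub_smul, one_smul]; abel
      have hcoef : 0 ≤ 1 - lam / N := sub_nonneg.mpr ((div_le_one hNpos).mpr hx.le)
      have hPy : ⟪M (P x), y⟫ = ⟪M (P x), P y⟫ := by
        have h := hPorth y (P x) (hPmem x)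
        rw [inner_map_comm hMsa, inner_sub_right] at h
        linarith
      have horth : ⟪M (P x), x - P x⟫ = 0 := by
        rw [inner_map_comm hMsa]; exact hPorth x _ (hPmem x)
      have hcs : ⟪M (P x), P y⟫ ≤ N * lam :=
        (inner_map_le_sqrt_mul_sqrt hMsa hMpos _ _).trans
          (mul_le_mul_of_nonneg_left hy hNpos.le)
      have hval : lam / N * (N * N) = N * lam := by field_simp
      rw [hxq, map_smul, real_inner_smul_left, inner_sub_right, inner_add_right, horth,
        real_inner_smul_right, hNsq, hPy, hval]
      exact mul_nonneg hcoef (by linarith)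
  · intro hx p
    exact isBestApprox_iff_eq_of_variational (C := fun y => √⟪M (P y), P y⟫ ≤ lam)
      hMsa hMpos hx (fun y _ => by simp) p
end

section
/- Let μ > 0 and m₁, m₂ > 0, and set w₁ := m₁/(m₁+m₂), w₂ := m₂/(m₁+m₂), μ̄ := μ(1/m₁ + 1/m₂). For (x₁,x₂) ∈ ℝ², let x̄ := w₁x₁ + w₂x₂. Then the unique minimizer over (y₁,y₂) ∈ ℝ² of (m₁/2)(x₁−y₁)² + (m₂/2)(x₂−y₂)² + μ|y₁−y₂| equals (x̄, x̄) + (1 − μ̄/|x₁−x₂|)·(w₂(x₁−x₂), w₁(x₂−x₁)) if |x₁−x₂| > μ̄, and equals (x̄, x̄) if |x₁−x₂| ≤ μ̄. -/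
/-- Strong convexity bound at a point `q` satisfying the optimality condition with subgradient `s`. -/
theorem prox_objective_strong_bound {mu m1 m2 x1 x2 q1 q2 s : ℝ}
    (hs : |s| ≤ mu) (hq : s * (q1 - q2) = mu * |q1 - q2|)
    (h1 : m1 * (x1 - q1) = s) (h2 : m2 * (x2 - q2) = -s) (y1 y2 : ℝ) :
    m1 / 2 * (x1 - q1) ^ 2 + m2 / 2 * (x2 - q2) ^ 2 + mu * |q1 - q2|
        + (m1 / 2 * (y1 - q1) ^ 2 + m2 / 2 * (y2 - q2) ^ 2)
      ≤ m1 / 2 * (x1 - y1) ^ 2 + m2 / 2 * (x2 - y2) ^ 2 + mu * |y1 - y2| := by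
  have hy : s * (y1 - y2) ≤ mu * |y1 - y2| :=
    (le_abs_self _).trans (by rw [abs_mul]; gcongr)
  linear_combination hy - hq - (q1 - y1) * h1 - (q2 - y2) * h2

/-- The optimality condition characterizes the unique minimizer of the proximal objective. -/
theorem prox_minimizer_iff_of_subgradient {mu m1 m2 x1 x2 q1 q2 s : ℝ}
    (hm1 : 0 < m1) (hm2 : 0 < m2)
    (hs : |s| ≤ mu) (hq : s * (q1 - q2) = mu * |q1 - q2|)
    (h1 : m1 * (x1 - q1) = s) (h2 : m2 * (x2 - q2) = -s) (p1 p2 : ℝ) :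
    (∀ y1 y2 : ℝ,
        m1 / 2 * (x1 - p1) ^ 2 + m2 / 2 * (x2 - p2) ^ 2 + mu * |p1 - p2|
          ≤ m1 / 2 * (x1 - y1) ^ 2 + m2 / 2 * (x2 - y2) ^ 2 + mu * |y1 - y2|)
      ↔ (p1 = q1 ∧ p2 = q2) := by
  have key := prox_objective_strong_bound hs hq h1 h2
  constructor
  · intro h
    have hle := h q1 q2
    have hkey := key p1 p2
    have n1 : 0 ≤ m1 / 2 * (p1 - q1) ^ 2 := by positivity
    have n2 : 0 ≤ m2 / 2 * (p2 - q2) ^ 2 := by positivity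
    have e1 : m1 / 2 * (p1 - q1) ^ 2 = 0 := by linarith
    have e2 : m2 / 2 * (p2 - q2) ^ 2 = 0 := by linarith
    simp only [mul_eq_zero, div_eq_zero_iff, hm1.ne', hm2.ne', OfNat.ofNat_ne_zero, false_or,
      pow_eq_zero_iff, ne_eq, not_false_eq_true, sub_eq_zero] at e1 e2
    exact ⟨e1, e2⟩
  · rintro ⟨rfl, rfl⟩ y1 y2
    refine le_trans (le_add_of_nonneg_right ?_) (key y1 y2)
    positivity

/-- Proposition 4.1 (ii): the proximity operator of `μ|y₁ - y₂|` in the diagonal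
metric `M = diag(m₁, m₂)` on `ℝ²`. -/
theorem prox_abs_diff_metric (mu m1 m2 x1 x2 : ℝ) (hmu : 0 < mu)
    (hm1 : 0 < m1) (hm2 : 0 < m2) :
    (|x1 - x2| > mu * (1 / m1 + 1 / m2) →
      ∀ p1 p2 : ℝ,
        (∀ y1 y2 : ℝ,
            m1 / 2 * (x1 - p1) ^ 2 + m2 / 2 * (x2 - p2) ^ 2 + mu * |p1 - p2|
              ≤ m1 / 2 * (x1 - y1) ^ 2 + m2 / 2 * (x2 - y2) ^ 2 + mu * |y1 - y2|)
          ↔ (p1 = (m1 / (m1 + m2) * x1 + m2 / (m1 + m2) * x2)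
                + (1 - (mu * (1 / m1 + 1 / m2)) / |x1 - x2|) * (m2 / (m1 + m2) * (x1 - x2)) ∧
             p2 = (m1 / (m1 + m2) * x1 + m2 / (m1 + m2) * x2)
                + (1 - (mu * (1 / m1 + 1 / m2)) / |x1 - x2|) * (m1 / (m1 + m2) * (x2 - x1)))) ∧
    (|x1 - x2| ≤ mu * (1 / m1 + 1 / m2) →
      ∀ p1 p2 : ℝ,
        (∀ y1 y2 : ℝ,
            m1 / 2 * (x1 - p1) ^ 2 + m2 / 2 * (x2 - p2) ^ 2 + mu * |p1 - p2|
              ≤ m1 / 2 * (x1 - y1) ^ 2 + m2 / 2 * (x2 - y2) ^ 2 + mu * |y1 - y2|)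
          ↔ (p1 = m1 / (m1 + m2) * x1 + m2 / (m1 + m2) * x2 ∧
             p2 = m1 / (m1 + m2) * x1 + m2 / (m1 + m2) * x2)) := by
  have hm : 0 < m1 + m2 := add_pos hm1 hm2
  constructor
  · intro h
    have hd : 0 < |x1 - x2| := lt_trans (by positivity) h
    refine prox_minimizer_iff_of_subgradient (s := mu * ((x1 - x2) / |x1 - x2|)) hm1 hm2 ?_ ?_ ?_ ?_
    · rw [abs_mul, abs_div, abs_abs, div_self hd.ne', abs_of_pos hmu, mul_one]
    · have hc : 0 ≤ 1 - mu * (1 / m1 + 1 / m2) / |x1 - x2| :=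
        sub_nonneg.2 ((div_le_one hd).2 h.le)
      generalize 1 - mu * (1 / m1 + 1 / m2) / |x1 - x2| = c at hc ⊢
      rw [show m1 / (m1 + m2) * x1 + m2 / (m1 + m2) * x2 + c * (m2 / (m1 + m2) * (x1 - x2))
          - (m1 / (m1 + m2) * x1 + m2 / (m1 + m2) * x2 + c * (m1 / (m1 + m2) * (x2 - x1)))
          = c * (x1 - x2) by field_simp; ring, abs_mul, abs_of_nonneg hc]
      have hsq := sq_abs (x1 - x2)
      field_simp
      linear_combination -c * hsq
    · field_simp
      ring
    · field_simp
      ring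
  · intro h
    refine prox_minimizer_iff_of_subgradient (s := m1 * m2 / (m1 + m2) * (x1 - x2))
      hm1 hm2 ?_ ?_ ?_ ?_
    · rw [abs_mul, abs_of_pos (by positivity)]
      calc m1 * m2 / (m1 + m2) * |x1 - x2|
          ≤ m1 * m2 / (m1 + m2) * (mu * (1 / m1 + 1 / m2)) := by gcongr
        _ = mu := by field_simp; ring
    · simp
    · field_simp
      ring
    · field_simp
      ring
end

section
/- Let H be a real Hilbert space, α, α' ∈ (0,1), and T, T' : H → H. If T is α-averaged in H and T' is α'-averaged in H, then the composition T ∘ T' is ((α + α' − 2αα')/(1 − αα'))-averaged in H (note that (α + α' − 2αα')/(1 − αα') ∈ (0,1)). -/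
/-- The distance between `v` and a multiple of `u`, in terms of `‖v‖`, `‖u‖` and `‖v - u‖`. -/
lemma norm_sub_smul_sq {H : Type*} [NormedAddCommGroup H] [InnerProductSpace ℝ H]
    (a : ℝ) (u v : H) :
    ‖v - (1 - a) • u‖ ^ 2
      = (a * ‖u‖) ^ 2 + (a * (‖v‖ ^ 2 - ‖u‖ ^ 2) + (1 - a) * ‖v - u‖ ^ 2) := by
  rw [norm_sub_sq_real, norm_sub_sq_real, norm_smul, real_inner_smul_right, mul_pow,
    Real.norm_eq_abs, sq_abs]
  ring

/-- `T` is `a`-averaged if and only if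
`‖T x - T y‖² ≤ ‖x - y‖² - (1 - a) / a * ‖(T x - T y) - (x - y)‖²` for all `x` and `y`. -/
lemma averaged_iff {H : Type*} [NormedAddCommGroup H] [InnerProductSpace ℝ H]
    {a : ℝ} (ha : 0 < a) (T : H → H) :
    (∃ R : H → H, (∀ x y : H, ‖R x - R y‖ ≤ ‖x - y‖) ∧ ∀ x : H, T x = a • R x + (1 - a) • x) ↔
      ∀ x y : H, a * (‖T x - T y‖ ^ 2 - ‖x - y‖ ^ 2)
        + (1 - a) * ‖(T x - T y) - (x - y)‖ ^ 2 ≤ 0 := by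
  constructor
  · rintro ⟨R, hR, hT⟩ x y
    have hsub : (T x - T y) - (1 - a) • (x - y) = a • (R x - R y) := by
      rw [hT, hT]
      module
    have hsq := norm_sub_smul_sq a (x - y) (T x - T y)
    rw [hsub, norm_smul, Real.norm_of_nonneg ha.le] at hsq
    have hle : (a * ‖R x - R y‖) ^ 2 ≤ (a * ‖x - y‖) ^ 2 := by
      gcongr
      exact hR x y
    linarith
  · intro h
    refine ⟨fun x => a⁻¹ • (T x - (1 - a) • x), fun x y => ?_, fun x => ?_⟩
    · have hsub : a⁻¹ • (T x - (1 - a) • x) - a⁻¹ • (T y - (1 - a) • y)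
          = a⁻¹ • ((T x - T y) - (1 - a) • (x - y)) := by
        module
      rw [hsub, norm_smul, norm_inv, Real.norm_of_nonneg ha.le, inv_mul_le_iff₀ ha]
      refine (sq_le_sq₀ (norm_nonneg _) (by positivity)).mp ?_
      have hsq := norm_sub_smul_sq a (x - y) (T x - T y)
      linarith [h x y]
    · rw [smul_inv_smul₀ ha.ne']
      module

/-- A weighted form of the parallelogram inequality for `‖c + d‖²`. -/
lemma mul_norm_add_sq_le {H : Type*} [NormedAddCommGroup H] [InnerProductSpace ℝ H]
    (p q : ℝ) (c d : H) :
    p * q * ‖c + d‖ ^ 2 ≤ (p + q) * (p * ‖c‖ ^ 2 + q * ‖d‖ ^ 2) := by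
  have h : 0 ≤ ‖p • c - q • d‖ ^ 2 := sq_nonneg _
  rw [norm_sub_sq_real, norm_smul, norm_smul, mul_pow, mul_pow, Real.norm_eq_abs,
    Real.norm_eq_abs, sq_abs, sq_abs, real_inner_smul_left, real_inner_smul_right] at h
  rw [norm_add_sq_real]
  linarith

/-- Lemma 5.1 (iii): the composition of an `α`-averaged and an `α'`-averaged operator
is `((α + α' − 2αα')/(1 − αα'))`-averaged, and this coefficient lies in `(0,1)`. -/
theorem averaged_comp
    {H : Type*} [NormedAddCommGroup H] [InnerProductSpace ℝ H]
    (α α' : ℝ) (hα : α ∈ Set.Ioo (0 : ℝ) 1) (hα' : α' ∈ Set.Ioo (0 : ℝ) 1)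
    (T T' : H → H)
    (hT : ∃ R : H → H, (∀ x y : H, ‖R x - R y‖ ≤ ‖x - y‖) ∧
        ∀ x : H, T x = α • R x + (1 - α) • x)
    (hT' : ∃ R : H → H, (∀ x y : H, ‖R x - R y‖ ≤ ‖x - y‖) ∧
        ∀ x : H, T' x = α' • R x + (1 - α') • x) :
    (α + α' - 2 * α * α') / (1 - α * α') ∈ Set.Ioo (0 : ℝ) 1 ∧
    ∃ R : H → H, (∀ x y : H, ‖R x - R y‖ ≤ ‖x - y‖) ∧
      ∀ x : H, T (T' x)
        = ((α + α' - 2 * α * α') / (1 - α * α')) • R x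
          + (1 - (α + α' - 2 * α * α') / (1 - α * α')) • x := by
  obtain ⟨h0, h1⟩ := hα
  obtain ⟨h0', h1'⟩ := hα'
  have hD : 0 < 1 - α * α' := by nlinarith
  have hk : 0 < α + α' - 2 * α * α' := by nlinarith
  have hγ : 0 < (α + α' - 2 * α * α') / (1 - α * α') := div_pos hk hD
  refine ⟨⟨hγ, (div_lt_one hD).mpr (by nlinarith)⟩, ?_⟩
  rw [averaged_iff h0] at hT
  rw [averaged_iff h0'] at hT'
  refine (averaged_iff hγ fun x => T (T' x)).mpr fun x y => ?_
  have hA := mul_le_mul_of_nonneg_left (hT' x y) (mul_pos hk h0).le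
  have hB := mul_le_mul_of_nonneg_left (hT (T' x) (T' y)) (mul_pos hk h0').le
  have hC := mul_norm_add_sq_le (α' * (1 - α)) (α * (1 - α'))
    ((T (T' x) - T (T' y)) - (T' x - T' y)) ((T' x - T' y) - (x - y))
  rw [sub_add_sub_cancel] at hC
  have hcompl : 1 - (α + α' - 2 * α * α') / (1 - α * α')
      = (1 - α) * (1 - α') / (1 - α * α') := by
    field_simp
    ring
  rw [hcompl, div_mul_eq_mul_div, div_mul_eq_mul_div, ← add_div]
  refine div_nonpos_of_nonpos_of_nonneg ?_ hD.le
  refine nonpos_of_mul_nonpos_right (a := α * α') ?_ (mul_pos h0 h0')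
  linarith
end

section
/- Let H be a real Hilbert space, L ∈ S++(H), and let f : H → ℝ be convex and everywhere (Fréchet) differentiable with gradient ∇f. If ‖L^{-1}∇f x − L^{-1}∇f y‖_L ≤ ‖x − y‖_L for all x, y ∈ H (i.e., the gradient of f in H_L is nonexpansive), then for all x, y ∈ H, ⟨∇f x − ∇f y | x − y⟩ ≥ ⟨L^{-1}(∇f x − ∇f y) | ∇f x − ∇f y⟩ = ‖∇f x − ∇f y‖²_{L^{-1}}. -/
open scoped RealInnerProductSpace

section GradientInequalities

variable {H : Type*} [NormedAddCommGroup H] [InnerProductSpace ℝ H] [CompleteSpace H]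

theorem HasGradientAt.hasDerivAt_add_smul {f : H → ℝ} {g x v : H} {t : ℝ}
    (hf : HasGradientAt f g (x + t • v)) :
    HasDerivAt (fun s : ℝ => f (x + s • v)) ⟪g, v⟫ t := by
  have hline : HasDerivAt (fun s : ℝ => x + s • v) v t := by
    simpa using ((hasDerivAt_id t).smul_const v).const_add x
  exact (hf.hasFDerivAt.comp_hasDerivAt t hline).congr_deriv (by simp)

/-- A differentiable convex function lies above its tangent planes. -/
theorem ConvexOn.add_inner_gradient_le {f : H → ℝ} (hconv : ConvexOn ℝ Set.univ f)
    {g x : H} (hf : HasGradientAt f g x) (y : H) :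
    f x + ⟪g, y - x⟫ ≤ f y := by
  have hline : ConvexOn ℝ Set.univ (fun s : ℝ => f (x + s • (y - x))) := by
    have h := hconv.comp_affineMap (AffineMap.lineMap x y : ℝ →ᵃ[ℝ] H)
    simpa [Function.comp_def, AffineMap.lineMap_apply, add_comm] using h
  have hderiv : HasDerivAt (fun s : ℝ => f (x + s • (y - x))) ⟪g, y - x⟫ 0 :=
    HasGradientAt.hasDerivAt_add_smul (by simpa using hf)
  have h := hline.le_slope_of_hasDerivAt (Set.mem_univ 0) (Set.mem_univ 1) one_pos hderiv
  simp [slope_def_field] at h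
  linarith

/-- The descent lemma, for a gradient whose variation is bounded by a quadratic form. -/
theorem le_add_inner_gradient_add_half {f : H → ℝ} {f' : H → H}
    (hf' : ∀ x, HasGradientAt f (f' x) x) (L : H →L[ℝ] H)
    (hL : ∀ x y, ⟪f' x - f' y, x - y⟫ ≤ ⟪L (x - y), x - y⟫) (x v : H) :
    f (x + v) ≤ f x + ⟪f' x, v⟫ + ⟪L v, v⟫ / 2 := by
  have hderiv : ∀ t : ℝ, HasDerivAt
      (fun s : ℝ => f (x + s • v) - s * ⟪f' x, v⟫ - s ^ 2 * (⟪L v, v⟫ / 2))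
      (⟪f' (x + t • v), v⟫ - ⟪f' x, v⟫ - t * ⟪L v, v⟫) t := by
    intro t
    have h := ((hf' (x + t • v)).hasDerivAt_add_smul.sub
      ((hasDerivAt_id t).mul_const ⟪f' x, v⟫)).sub
      ((hasDerivAt_pow 2 t).mul_const (⟪L v, v⟫ / 2))
    exact h.congr_deriv (by simp; ring)
  have hanti : AntitoneOn
      (fun s : ℝ => f (x + s • v) - s * ⟪f' x, v⟫ - s ^ 2 * (⟪L v, v⟫ / 2)) (Set.Ici 0) := by
    refine antitoneOn_of_deriv_nonpos (convex_Ici 0)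
      (fun t _ => (hderiv t).continuousAt.continuousWithinAt)
      (fun t _ => (hderiv t).differentiableAt.differentiableWithinAt) fun t ht => ?_
    rw [interior_Ici, Set.mem_Ioi] at ht
    rw [(hderiv t).deriv]
    have h := hL (x + t • v) x
    simp only [add_sub_cancel_left, map_smul, inner_smul_left, inner_smul_right,
      inner_sub_left, conj_trivial] at h
    exact le_of_mul_le_mul_left (by linarith) ht
  have h := hanti (Set.mem_Ici.2 le_rfl) (Set.mem_Ici.2 zero_le_one) zero_le_one
  simp at h
  linarith

end GradientInequalities

/-- Remark 2.2 / Corollary 5.1, (h1) ⇒ (H1): if `f` is convex and differentiable with a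
gradient that is nonexpansive in the metric of `L`, then
`⟨∇f x − ∇f y | x − y⟩ ≥ ‖∇f x − ∇f y‖²_{L⁻¹}`. -/
theorem gradient_cocoercive_of_nonexpansive_metric
    {H : Type*} [NormedAddCommGroup H] [InnerProductSpace ℝ H] [CompleteSpace H]
    (L : H →L[ℝ] H)
    (hLsa : ∀ u v : H, ⟪L u, v⟫ = ⟪u, L v⟫)
    (hLpos : ∃ m > (0 : ℝ), ∀ u : H, m * ‖u‖ ^ 2 ≤ ⟪L u, u⟫)
    (Linv : H →L[ℝ] H)
    (hLinv₁ : L.comp Linv = ContinuousLinearMap.id ℝ H)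
    (hLinv₂ : Linv.comp L = ContinuousLinearMap.id ℝ H)
    (f : H → ℝ) (hfconv : ConvexOn ℝ Set.univ f)
    (f' : H → H) (hf' : ∀ x : H, HasGradientAt f (f' x) x)
    (hne : ∀ x y : H,
      Real.sqrt ⟪L (Linv (f' x) - Linv (f' y)), Linv (f' x) - Linv (f' y)⟫
        ≤ Real.sqrt ⟪L (x - y), x - y⟫) :
    ∀ x y : H, ⟪Linv (f' x - f' y), f' x - f' y⟫ ≤ ⟪f' x - f' y, x - y⟫ := by
  obtain ⟨m, hm, hmL⟩ := hLpos
  have hnonneg : ∀ u : H, 0 ≤ ⟪L u, u⟫ := fun u => le_trans (by positivity) (hmL u)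
  have hLLinv : ∀ u : H, L (Linv u) = u := fun u => DFunLike.congr_fun hLinv₁ u
  have hbound : ∀ x y : H, ⟪f' x - f' y, x - y⟫ ≤ ⟪L (x - y), x - y⟫ := by
    intro x y
    have hle := (Real.sqrt_le_sqrt_iff (hnonneg _)).1 (hne x y)
    rw [← map_sub, hLLinv] at hle
    have hsq := hnonneg (Linv (f' x - f' y) - (x - y))
    have hsymm : ⟪L (x - y), Linv (f' x - f' y)⟫ = ⟪f' x - f' y, x - y⟫ := by
      rw [hLsa, hLLinv, real_inner_comm]
    rw [map_sub L, hLLinv, inner_sub_left, inner_sub_right _ (Linv _),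
      inner_sub_right _ (Linv _), hsymm] at hsq
    linarith
  have hlower : ∀ x y : H,
      f x + ⟪f' x, y - x⟫ + ⟪Linv (f' x - f' y), f' x - f' y⟫ / 2 ≤ f y := by
    intro x y
    have htangent := hfconv.add_inner_gradient_le (hf' x) (y + Linv (f' x - f' y))
    have hdescent := le_add_inner_gradient_add_half hf' L hbound y (Linv (f' x - f' y))
    rw [add_sub_right_comm, inner_add_right] at htangent
    rw [hLLinv, real_inner_comm (Linv _) (f' x - f' y)] at hdescent
    have hsplit : ⟪Linv (f' x - f' y), f' x - f' y⟫ =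
        ⟪f' x, Linv (f' x - f' y)⟫ - ⟪f' y, Linv (f' x - f' y)⟫ := by
      rw [real_inner_comm, inner_sub_left]
    linarith
  intro x y
  have hxy := hlower x y
  have hyx := hlower y x
  rw [← neg_sub (f' x) (f' y), map_neg, inner_neg_neg] at hyx
  rw [← neg_sub x y, inner_neg_right] at hxy
  rw [inner_sub_left (f' x) (f' y) (x - y)]
  linarith
end
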